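/- Let T be the 4×4 complex matrix T = (1/√2) · [[1,0,0,1],[0,i,i,0],[0,−1,1,0],[i,0,0,−i]]. For all 2×2 complex matrices A, B with det A = det B = 1 (i.e. A, B ∈ SL(2,ℂ)), the matrix M = T (A ⊗ B) T† satisfies Mᵀ M = I₄ and det M = 1; that is, M belongs to the complex special orthogonal group SO(4,ℂ). -/

import Mathlib

open Matrix

noncomputable section

/-- The fixed matrix `T = (1/√2)·[[1,0,0,1],[0,i,i,0],[0,-1,1,0],[i,0,0,-i]]`. -/
noncomputable def Tmat : Matrix (Fin 4) (Fin 4) ℂ :=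
  ((1 / Real.sqrt 2 : ℝ) : ℂ) •
    !![1, 0, 0, 1;
       0, Complex.I, Complex.I, 0;
       0, -1, 1, 0;
       Complex.I, 0, 0, -Complex.I]

/-- The index identification `(i,j) ↦ 2i+j` between `Fin 2 × Fin 2` (ordered 00,01,10,11)
and `Fin 4`. -/
def qIdx : Fin 2 × Fin 2 ≃ Fin 4 where
  toFun p := ⟨2 * p.1.val + p.2.val, by have h1 := p.1.isLt; have h2 := p.2.isLt; omega⟩
  invFun k := (⟨k.val / 2, by have := k.isLt; omega⟩, ⟨k.val % 2, by have := k.isLt; omega⟩)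
  left_inv := by decide
  right_inv := by decide

/-- Kronecker product of two `2×2` matrices as a `4×4` matrix (basis ordered 00,01,10,11). -/
def kron (A B : Matrix (Fin 2) (Fin 2) ℂ) : Matrix (Fin 4) (Fin 4) ℂ :=
  fun r c => A (qIdx.symm r).1 (qIdx.symm c).1 * B (qIdx.symm r).2 (qIdx.symm c).2

/-- The matrix of the bilinear form `ε ⊗ ε`, where `ε` is the standard symplectic form on `ℂ²`. -/
def epsKron : Matrix (Fin 4) (Fin 4) ℂ :=
  !![0, 0, 0, 1; 0, 0, -1, 0; 0, -1, 0, 0; 1, 0, 0, 0]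

lemma ofReal_one_div_sqrt_two_mul_self :
    ((1 / Real.sqrt 2 : ℝ) : ℂ) * ((1 / Real.sqrt 2 : ℝ) : ℂ) = 1 / 2 := by
  rw [← Complex.ofReal_mul, div_mul_div_comm, Real.mul_self_sqrt zero_le_two]
  norm_num

lemma Tmat_mul_conjTranspose : Tmat * Tmatᴴ = 1 := by
  rw [Tmat, conjTranspose_smul, smul_mul_smul_comm, Complex.star_def, Complex.conj_ofReal,
    ofReal_one_div_sqrt_two_mul_self]
  ext i j
  simp only [Matrix.smul_apply, mul_apply, Fin.sum_univ_four, conjTranspose_apply]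
  fin_cases i <;> fin_cases j <;> simp <;> norm_num

lemma Tmat_transpose_mul : Tmatᵀ * Tmat = epsKron := by
  rw [Tmat, transpose_smul, smul_mul_smul_comm, ofReal_one_div_sqrt_two_mul_self]
  ext i j
  fin_cases i <;> fin_cases j <;>
    simp [epsKron, mul_apply, Fin.sum_univ_four] <;> norm_num

lemma kron_eq_reindex (A B : Matrix (Fin 2) (Fin 2) ℂ) :
    kron A B = reindex qIdx qIdx (kroneckerMap (· * ·) A B) := rfl

lemma det_kron (A B : Matrix (Fin 2) (Fin 2) ℂ) :
    (kron A B).det = A.det ^ 2 * B.det ^ 2 := by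
  rw [kron_eq_reindex, det_reindex_self, det_kronecker, Fintype.card_fin]

lemma kron_transpose_mul_epsKron_mul (A B : Matrix (Fin 2) (Fin 2) ℂ) :
    (kron A B)ᵀ * epsKron * kron A B = (A.det * B.det) • epsKron := by
  rw [det_fin_two, det_fin_two]
  ext i j
  fin_cases i <;> fin_cases j <;>
    simp [epsKron, kron, qIdx, mul_apply, Fin.sum_univ_four] <;> ring

/-- For `A, B ∈ SL(2,ℂ)`, the matrix `M = T (A ⊗ B) T†` satisfies `Mᵀ M = 1` and
`det M = 1`, i.e. `M ∈ SO(4,ℂ)`. -/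
theorem sl2_sl2_to_so4_complex (A B : Matrix (Fin 2) (Fin 2) ℂ)
    (hA : A.det = 1) (hB : B.det = 1) :
    (Tmat * kron A B * Tmatᴴ)ᵀ * (Tmat * kron A B * Tmatᴴ) = 1 ∧
    (Tmat * kron A B * Tmatᴴ).det = 1 := by
  have hT : Tmatᴴ * Tmat = 1 := mul_eq_one_comm.mp Tmat_mul_conjTranspose
  have hTt : Tmatᴴᵀ * Tmatᵀ = 1 := by rw [← transpose_mul, Tmat_mul_conjTranspose, transpose_one]
  have hK : (kron A B)ᵀ * epsKron * kron A B = epsKron := by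
    rw [kron_transpose_mul_epsKron_mul, hA, hB, one_mul, one_smul]
  constructor
  · calc (Tmat * kron A B * Tmatᴴ)ᵀ * (Tmat * kron A B * Tmatᴴ)
        = Tmatᴴᵀ * ((kron A B)ᵀ * (Tmatᵀ * Tmat) * kron A B) * Tmatᴴ := by
          simp only [transpose_mul, Matrix.mul_assoc]
      _ = (Tmatᴴᵀ * Tmatᵀ) * (Tmat * Tmatᴴ) := by
          rw [Tmat_transpose_mul, hK, ← Tmat_transpose_mul]
          simp only [Matrix.mul_assoc]
      _ = 1 := by rw [hTt, Tmat_mul_conjTranspose, one_mul]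
  · rw [det_mul_comm, ← Matrix.mul_assoc, hT, one_mul, det_kron, hA, hB]
    norm_num
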